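/- Let G be a connected simple graph on [N] with an edge e = uv such that deg_G(u) = 2, and let c = (c_1,…,c_N) be a D(G)-draconian sequence. If the length-(N+1) sequence obtained from c by increasing c_v by 1 and appending 0 is NOT of the form (c'_1,…,c'_u+1,…,c'_N, 0) for some D(G)-draconian sequence c', then that sequence (increase c_v by 1, append 0) is D(G△e)-draconian; otherwise, c_u ≥ 1 and the sequence obtained from c by decreasing c_u by 1 and appending 2 is D(G△e)-draconian. -/

import Mathlib

open Finset

attribute [local instance] Classical.propDecidable

/-- The set of neighbors of `i` in `G`, as a `Finset`. -/
noncomputable def nbr {N : ℕ} (G : SimpleGraph (Fin N)) (i : Fin N) : Finset (Fin N) :=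
  Finset.univ.filter (fun j => G.Adj i j)

/-- `(a 1, …, a N)` is a `D(G)`-draconian sequence: the entries sum to `N - 1` and for
every nonempty `S ⊆ [N]` one has `∑_{i ∈ S} a i < |S ∪ ⋃_{i ∈ S} N_G(i)|`. -/
def draconian {N : ℕ} (G : SimpleGraph (Fin N)) (a : Fin N → ℕ) : Prop :=
  (∑ i, a i) = N - 1 ∧
  ∀ S : Finset (Fin N), S.Nonempty →
    (∑ i ∈ S, a i) < (S ∪ S.biUnion (fun i => nbr G i)).card

/-- The subdivision `G : e` of the edge `e = uv` of `G`: the graph on `[N+1]` with edge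
set `(E(G) ∖ {uv}) ∪ {u(N+1), v(N+1)}`. -/
def subdiv {N : ℕ} (G : SimpleGraph (Fin N)) (u v : Fin N) : SimpleGraph (Fin (N + 1)) :=
  SimpleGraph.fromRel (fun i j =>
    (∃ a b : Fin N, i = a.castSucc ∧ j = b.castSucc ∧ G.Adj a b ∧
      ¬(a = u ∧ b = v) ∧ ¬(a = v ∧ b = u))
    ∨ (i = u.castSucc ∧ j = Fin.last N) ∨ (i = v.castSucc ∧ j = Fin.last N))

/-- The graph `G △ e` for an edge `e = uv` of `G`: the graph on `[N+1]` with edge set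
`E(G) ∪ {u(N+1), v(N+1)}`. -/
def triExt {N : ℕ} (G : SimpleGraph (Fin N)) (u v : Fin N) : SimpleGraph (Fin (N + 1)) :=
  SimpleGraph.fromRel (fun i j =>
    (∃ a b : Fin N, i = a.castSucc ∧ j = b.castSucc ∧ G.Adj a b)
    ∨ (i = u.castSucc ∧ j = Fin.last N) ∨ (i = v.castSucc ∧ j = Fin.last N))

/-- A graph on `[N]` is `2`-connected if it has at least `3` vertices, is connected, and
remains connected after deleting any single vertex. -/
def TwoConnected {N : ℕ} (G : SimpleGraph (Fin N)) : Prop :=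
  3 ≤ N ∧ G.Connected ∧
    ∀ v : Fin N, (G.comap (fun u : {w : Fin N // w ≠ v} => (u : Fin N))).Connected

/-- The closed neighborhood `S ∪ ⋃_{i ∈ S} N_G(i)` of a set of vertices. -/
noncomputable def closedNbr {N : ℕ} (G : SimpleGraph (Fin N)) (S : Finset (Fin N)) :
    Finset (Fin N) :=
  S ∪ S.biUnion (fun i => nbr G i)

theorem mem_closedNbr {N : ℕ} {G : SimpleGraph (Fin N)} {S : Finset (Fin N)} {x : Fin N} :
    x ∈ closedNbr G S ↔ x ∈ S ∨ ∃ i ∈ S, G.Adj i x := by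
  simp [closedNbr, nbr]

theorem triExt_adj_castSucc {N : ℕ} {G : SimpleGraph (Fin N)} {u v a b : Fin N}
    (h : G.Adj a b) : (triExt G u v).Adj a.castSucc b.castSucc :=
  (SimpleGraph.fromRel_adj _ _ _).2
    ⟨fun hab => h.ne (Fin.castSucc_injective N hab), Or.inl (Or.inl ⟨a, b, rfl, rfl, h⟩)⟩

theorem triExt_adj_last {N : ℕ} {G : SimpleGraph (Fin N)} {u v a : Fin N}
    (h : a = u ∨ a = v) : (triExt G u v).Adj a.castSucc (Fin.last N) :=
  (SimpleGraph.fromRel_adj _ _ _).2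
    ⟨(Fin.castSucc_lt_last a).ne, Or.inl (Or.inr (by rcases h with rfl | rfl <;> simp))⟩

theorem map_closedNbr_subset_triExt {N : ℕ} {G : SimpleGraph (Fin N)} {u v : Fin N}
    {T : Finset (Fin N)} {S : Finset (Fin (N + 1))} (h : T.map Fin.castSuccEmb ⊆ S) :
    (closedNbr G T).map Fin.castSuccEmb ⊆ closedNbr (triExt G u v) S := by
  intro y hy
  obtain ⟨x, hx, rfl⟩ := mem_map.1 hy
  rcases mem_closedNbr.1 hx with hx | ⟨i, hi, hix⟩
  · exact mem_closedNbr.2 (Or.inl (h (mem_map_of_mem _ hx)))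
  · exact mem_closedNbr.2
      (Or.inr ⟨i.castSucc, h (mem_map_of_mem Fin.castSuccEmb hi), triExt_adj_castSucc hix⟩)

theorem last_notMem_map_castSuccEmb {N : ℕ} (T : Finset (Fin N)) :
    Fin.last N ∉ T.map Fin.castSuccEmb := by
  simp

theorem exists_eq_map_castSuccEmb {N : ℕ} (S : Finset (Fin (N + 1))) :
    ∃ T : Finset (Fin N), S = T.map Fin.castSuccEmb ∨
      S = insert (Fin.last N) (T.map Fin.castSuccEmb) := by
  refine ⟨univ.filter (fun i => i.castSucc ∈ S), ?_⟩
  by_cases h : Fin.last N ∈ S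
  · right
    ext x
    cases x using Fin.lastCases <;> simp [h]
  · left
    ext x
    cases x using Fin.lastCases <;> simp [h]

theorem draconian_triExt_snoc {N : ℕ} {G : SimpleGraph (Fin N)} {u v : Fin N}
    {a : Fin N → ℕ} {z : ℕ} (hsum : ∑ i, a i + z = N)
    (hwithout : ∀ T : Finset (Fin N), T.Nonempty →
      ∑ i ∈ T, a i < (closedNbr G T).card + if u ∈ T ∨ v ∈ T then 1 else 0)
    (hwith : ∀ T : Finset (Fin N),
      ∑ i ∈ T, a i + z < (closedNbr G T ∪ {u, v}).card + 1) :
    draconian (triExt G u v) (Fin.snoc a z) := by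
  refine ⟨by simpa [Fin.sum_univ_castSucc] using hsum, fun S hS => ?_⟩
  change _ < (closedNbr (triExt G u v) S).card
  have hcard (X : Finset (Fin N)) :
      (insert (Fin.last N) (X.map Fin.castSuccEmb)).card = X.card + 1 := by
    rw [card_insert_of_notMem (last_notMem_map_castSuccEmb X), card_map]
  obtain ⟨T, rfl | rfl⟩ := exists_eq_map_castSuccEmb S
  · have hsub := map_closedNbr_subset_triExt (G := G) (u := u) (v := v)
      (Subset.refl (T.map Fin.castSuccEmb))
    have hlt := hwithout T (map_nonempty.1 hS)
    have hsumT : ∑ i ∈ T.map Fin.castSuccEmb, (Fin.snoc a z : Fin (N + 1) → ℕ) i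
        = ∑ i ∈ T, a i := by
      simp
    rw [hsumT]
    refine hlt.trans_le ?_
    split_ifs with h
    · rw [← hcard]
      refine card_le_card (insert_subset (mem_closedNbr.2 (Or.inr ?_)) hsub)
      rcases h with h | h
      · exact ⟨_, mem_map_of_mem Fin.castSuccEmb h, triExt_adj_last (Or.inl rfl)⟩
      · exact ⟨_, mem_map_of_mem Fin.castSuccEmb h, triExt_adj_last (Or.inr rfl)⟩
    · simpa using card_le_card hsub
  · have hsub := map_closedNbr_subset_triExt (G := G) (u := u) (v := v)
      (subset_insert (Fin.last N) (T.map Fin.castSuccEmb))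
    have hsumT : ∑ i ∈ insert (Fin.last N) (T.map Fin.castSuccEmb),
        (Fin.snoc a z : Fin (N + 1) → ℕ) i = ∑ i ∈ T, a i + z := by
      rw [sum_insert (last_notMem_map_castSuccEmb T), add_comm]
      simp
    rw [hsumT]
    refine (hwith T).trans_le ?_
    rw [← hcard]
    refine card_le_card (insert_subset (mem_closedNbr.2 (Or.inl (mem_insert_self _ _))) ?_)
    rw [map_union]
    refine union_subset hsub fun y hy => ?_
    obtain ⟨x, hx, rfl⟩ := mem_map.1 hy
    exact mem_closedNbr.2 (Or.inr ⟨_, mem_insert_self _ _,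
      (triExt_adj_last (by simpa using hx)).symm⟩)

theorem sum_update_add_one {ι : Type*} [DecidableEq ι] (c : ι → ℕ) (v : ι) (T : Finset ι) :
    ∑ i ∈ T, Function.update c v (c v + 1) i = ∑ i ∈ T, c i + if v ∈ T then 1 else 0 := by
  split_ifs with h
  · rw [sum_update_of_mem h, sum_eq_add_sum_sdiff_singleton_of_mem h c]
    ring
  · rw [sum_update_of_notMem h, add_zero]

theorem sum_update_sub_one {ι : Type*} [DecidableEq ι] {c : ι → ℕ} {u : ι} (hu : 1 ≤ c u)
    (T : Finset ι) :
    ∑ i ∈ T, Function.update c u (c u - 1) i + (if u ∈ T then 1 else 0) = ∑ i ∈ T, c i := by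
  split_ifs with h
  · rw [sum_update_of_mem h, sum_eq_add_sum_sdiff_singleton_of_mem h c]
    lia
  · rw [sum_update_of_notMem h, add_zero]

/-- A vertex `u` of degree two lying outside `T`, with a neighbor `v` outside `T`, has its
closed neighborhood inside that of `T` once `u` and `v` belong to the latter. -/
theorem closedNbr_insert_eq {N : ℕ} {G : SimpleGraph (Fin N)} {u v : Fin N}
    (he : G.Adj u v) (hdeg : (nbr G u).card = 2) {T : Finset (Fin N)} (huT : u ∉ T)
    (hvT : v ∉ T) (hu : u ∈ closedNbr G T) (hv : v ∈ closedNbr G T) :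
    closedNbr G (insert u T) = closedNbr G T := by
  obtain ⟨x, hxT, hxu⟩ := (mem_closedNbr.1 hu).resolve_left huT
  have hvx : v ≠ x := fun h => hvT (h ▸ hxT)
  have hnbr : {v, x} = nbr G u := by
    refine eq_of_subset_of_card_le ?_ (by rw [hdeg, card_pair hvx])
    simp [insert_subset_iff, nbr, he, hxu.symm]
  ext y
  simp only [mem_closedNbr, mem_insert, exists_eq_or_imp]
  rw [← mem_closedNbr]
  constructor
  · rintro ((rfl | hy) | hy | hy)
    · exact hu
    · exact mem_closedNbr.2 (Or.inl hy)
    · have : y ∈ ({v, x} : Finset (Fin N)) := by simpa [hnbr, nbr] using hy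
      rcases mem_insert.1 this with rfl | h
      · exact hv
      · exact mem_closedNbr.2 (Or.inl (mem_singleton.1 h ▸ hxT))
    · exact mem_closedNbr.2 (Or.inr hy)
  · intro hy
    rcases mem_closedNbr.1 hy with h | h
    · exact Or.inl (Or.inr h)
    · exact Or.inr (Or.inr h)

/-- Let `G` be connected on `[N]` with an edge `e = uv` such that `deg_G(u) = 2`, and let `c`
be `D(G)`-draconian. If the sequence obtained from `c` by increasing `c v` by `1` and
appending `0` is not of the form `(c'_1, …, c'_u + 1, …, c'_N, 0)` for some `D(G)`-draconian
`c'`, then that sequence is `D(G△e)`-draconian; otherwise, `c u ≥ 1` and the sequence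
obtained from `c` by decreasing `c u` by `1` and appending `2` is `D(G△e)`-draconian. -/
theorem draconian_gamma_triExt {N : ℕ} (G : SimpleGraph (Fin N)) (hconn : G.Connected)
    (u v : Fin N) (he : G.Adj u v) (hdeg : (nbr G u).card = 2)
    (c : Fin N → ℕ) (hc : draconian G c) :
    (¬ (∃ c' : Fin N → ℕ, draconian G c' ∧
          (Fin.snoc (Function.update c v (c v + 1)) 0 : Fin (N + 1) → ℕ) =
            Fin.snoc (Function.update c' u (c' u + 1)) 0) →
      draconian (triExt G u v) (Fin.snoc (Function.update c v (c v + 1)) 0)) ∧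
    ((∃ c' : Fin N → ℕ, draconian G c' ∧
          (Fin.snoc (Function.update c v (c v + 1)) 0 : Fin (N + 1) → ℕ) =
            Fin.snoc (Function.update c' u (c' u + 1)) 0) →
      1 ≤ c u ∧ draconian (triExt G u v) (Fin.snoc (Function.update c u (c u - 1)) 2)) := by
  have hN : 0 < N := u.pos
  obtain ⟨hcsum, hclt⟩ := hc
  change ∀ S : Finset (Fin N), S.Nonempty → ∑ i ∈ S, c i < (closedNbr G S).card at hclt
  have hmono (T : Finset (Fin N)) :
      (closedNbr G T).card ≤ (closedNbr G T ∪ {u, v}).card :=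
    card_le_card subset_union_left
  refine ⟨fun _ => draconian_triExt_snoc ?_ (fun T hT => ?_) (fun T => ?_), ?_⟩
  · simp only [sum_update_add_one, mem_univ, if_true]
    lia
  · have := hclt T hT
    rw [sum_update_add_one]
    by_cases hvT : v ∈ T
    · rw [if_pos hvT, if_pos (Or.inr hvT)]
      lia
    · rw [if_neg hvT]
      lia
  · rw [sum_update_add_one]
    rcases T.eq_empty_or_nonempty with rfl | hT
    · simp
    · have := hclt T hT
      have := hmono T
      split_ifs <;> lia
  · rintro ⟨c', ⟨-, hc'lt⟩, heq⟩
    change ∀ S : Finset (Fin N), S.Nonempty → ∑ i ∈ S, c' i < (closedNbr G S).card at hc'lt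
    have hupd : Function.update c v (c v + 1) = Function.update c' u (c' u + 1) := by
      funext i
      simpa using congrFun heq i.castSucc
    have hcu : 1 ≤ c u := by
      have := congrFun hupd u
      rw [Function.update_of_ne he.ne, Function.update_self] at this
      lia
    refine ⟨hcu, draconian_triExt_snoc ?_ (fun T hT => ?_) (fun T => ?_)⟩
    · have := sum_update_sub_one hcu univ
      simp only [mem_univ, if_true] at this
      lia
    · have := sum_update_sub_one hcu T
      have := hclt T hT
      lia
    · have hsub := sum_update_sub_one hcu T
      have hmonoT := hmono T
      rcases T.eq_empty_or_nonempty with rfl | hT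
      · simp [closedNbr, card_pair he.ne]
      have hcT := hclt T hT
      by_cases huT : u ∈ T
      · rw [if_pos huT] at hsub
        lia
      rw [if_neg huT, add_zero] at hsub
      rw [hsub]
      by_cases hvT : v ∈ T
      · have hsumT := congrArg (fun f : Fin N → ℕ => ∑ i ∈ T, f i) hupd
        simp only [sum_update_add_one, if_pos hvT, if_neg huT, add_zero] at hsumT
        have := hc'lt T hT
        lia
      by_cases huv : u ∈ closedNbr G T ∧ v ∈ closedNbr G T
      · have hins := hclt (insert u T) (insert_nonempty u T)
        rw [closedNbr_insert_eq he hdeg huT hvT huv.1 huv.2, sum_insert huT] at hins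
        lia
      · have : (closedNbr G T).card < (closedNbr G T ∪ {u, v}).card := by
          refine card_lt_card (Finset.ssubset_iff_subset_ne.2 ⟨subset_union_left, fun h => huv ?_⟩)
          rw [h]
          simp
        lia
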